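/- Let h be a six-dimensional Lie algebra admitting linearly independent 1-forms α₁, α₂ ∈ h*, a closed 1-form γ (possibly zero) with γ vanishing on W := ker(dα₁), and 2-forms ω₁, ω₂ with ω_i ∧ ω_j = δ_{ij}ω₁², ω₁² ≠ 0, ker ω₁ = ker ω₂ two-dimensional and complementary to ker α₁ ∩ ker α₂, such that dα₁ = ω₁ and dα₂ = ω₂ + γ ∧ α₁. Then ρ := α₂ ∧ ω₁ − α₁ ∧ ω₂ is an exact SL(3,ℂ)-structure on h; indeed ρ = d(α₁ ∧ α₂). -/

import Mathlib

open Module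

/-- Wedge product of `k` covectors, as an alternating `k`-form (determinant convention). -/
noncomputable def wedgeCov {V : Type*} [AddCommGroup V] [Module ℝ V] {k : ℕ}
    (f : Fin k → Module.Dual ℝ V) : V [⋀^Fin k]→ₗ[ℝ] ℝ :=
  Matrix.detRowAlternating.compLinearMap (LinearMap.pi f)

/-- Wedge product of alternating forms (shuffle convention, compatible with `wedgeCov`). -/
noncomputable def aw {V : Type*} [AddCommGroup V] [Module ℝ V] {a b : ℕ}
    (ω : V [⋀^Fin a]→ₗ[ℝ] ℝ) (σ : V [⋀^Fin b]→ₗ[ℝ] ℝ) : V [⋀^Fin (a + b)]→ₗ[ℝ] ℝ :=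
  ((TensorProduct.lid ℝ ℝ).toLinearMap.compAlternatingMap (ω.domCoprod σ)).domDomCongr
    finSumFinEquiv

/-- The `i`-th coordinate covector on `Fin n → ℝ`. -/
noncomputable def pr {n : ℕ} (i : Fin n) : Module.Dual ℝ (Fin n → ℝ) := LinearMap.proj i

/-- The model `SL(3,ℂ)` three-form `ρ₀ = e¹³⁵ − e¹⁴⁶ − e²³⁶ − e²⁴⁵` on `ℝ⁶` (0-based indices). -/
noncomputable def rho0 : (Fin 6 → ℝ) [⋀^Fin 3]→ₗ[ℝ] ℝ :=
  wedgeCov ![pr 0, pr 2, pr 4] - wedgeCov ![pr 0, pr 3, pr 5] - wedgeCov ![pr 1, pr 2, pr 5] -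
    wedgeCov ![pr 1, pr 3, pr 4]

/-- A three-form on a real vector space is an `SL(3,ℂ)`-structure if it is linearly
equivalent to the model form `ρ₀`. -/
def IsSL3 {V : Type*} [AddCommGroup V] [Module ℝ V] (ρ : V [⋀^Fin 3]→ₗ[ℝ] ℝ) : Prop :=
  ∃ u : V ≃ₗ[ℝ] (Fin 6 → ℝ), ρ = rho0.compLinearMap u.toLinearMap

open Equiv in
theorem sum_perm_fin_succ {M : Type*} [AddCommMonoid M] {n : ℕ} (f : Perm (Fin (n + 1)) → M) :
    ∑ τ, f τ = ∑ p : Fin (n + 1), ∑ e : Perm (Fin n), f (Perm.decomposeFin.symm (p, e)) := by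
  rw [← Perm.decomposeFin.symm.sum_comp, Fintype.sum_prod_type]

/-- The wedge product as an unnormalised sum over all permutations. -/
theorem factorial_mul_aw_apply {V : Type*} [AddCommGroup V] [Module ℝ V] {a b : ℕ}
    (ω : V [⋀^Fin a]→ₗ[ℝ] ℝ) (σ : V [⋀^Fin b]→ₗ[ℝ] ℝ) (v : Fin (a + b) → V) :
    ((a.factorial * b.factorial : ℕ) : ℝ) * aw ω σ v =
      ∑ τ : Equiv.Perm (Fin (a + b)), ((Equiv.Perm.sign τ : ℤ) : ℝ) *
        (ω (fun i => v (τ (Fin.castAdd b i))) * σ (fun i => v (τ (Fin.natAdd a i)))) := by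
  have key := congrArg (fun f => TensorProduct.lid ℝ ℝ (f (v ∘ finSumFinEquiv)))
    (MultilinearMap.domCoprod_alternization_eq ω σ)
  simp only [Fintype.card_fin, AlternatingMap.smul_apply, map_nsmul,
    MultilinearMap.alternatization_apply, map_sum] at key
  rw [← nsmul_eq_mul]
  refine key.symm.trans ?_
  rw [← finSumFinEquiv.permCongr.sum_comp]
  refine Finset.sum_congr rfl fun τ _ => ?_
  rcases Int.units_eq_one_or (Equiv.Perm.sign τ) with hs | hs <;>
  simp [hs, Equiv.Perm.sign_permCongr, Function.comp_def]

theorem alt_two_swap {V : Type*} [AddCommGroup V] [Module ℝ V] (ω : V [⋀^Fin 2]→ₗ[ℝ] ℝ)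
    (a b : V) : ω ![b, a] = -ω ![a, b] := by
  rw [← ω.map_swap ![a, b] (i := 0) (j := 1) (by decide)]
  congr 1; ext i; fin_cases i <;> rfl

open Equiv in
theorem decomposeFin_symm_apply_two {n : ℕ} (e : Perm (Fin (n + 2))) (p : Fin (n + 3)) :
    Perm.decomposeFin.symm (p, e) 2 = swap 0 p (e 1).succ :=
  Perm.decomposeFin_symm_apply_succ e p 1

open Equiv in
theorem decomposeFin_symm_apply_three {n : ℕ} (e : Perm (Fin (n + 3))) (p : Fin (n + 4)) :
    Perm.decomposeFin.symm (p, e) 3 = swap 0 p (e 2).succ :=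
  Perm.decomposeFin_symm_apply_succ e p 2

theorem alt_two_eq {V : Type*} [AddCommGroup V] [Module ℝ V] (ω : V [⋀^Fin 2]→ₗ[ℝ] ℝ)
    (f : Fin 2 → V) : ω f = ω ![f 0, f 1] := by
  congr 1; ext i; fin_cases i <;> rfl

theorem aw_two_two_apply {V : Type*} [AddCommGroup V] [Module ℝ V]
    (ω σ : V [⋀^Fin 2]→ₗ[ℝ] ℝ) (a b c d : V) :
    (aw ω σ : V [⋀^Fin 4]→ₗ[ℝ] ℝ) ![a, b, c, d] =
      ω ![a, b] * σ ![c, d] - ω ![a, c] * σ ![b, d] + ω ![a, d] * σ ![b, c]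
      + ω ![b, c] * σ ![a, d] - ω ![b, d] * σ ![a, c] + ω ![c, d] * σ ![a, b] := by
  have h : (4 : ℝ) * aw ω σ ![a, b, c, d] = ∑ τ : Equiv.Perm (Fin 4),
      ((Equiv.Perm.sign τ : ℤ) : ℝ) * (ω ![![a, b, c, d] (τ 0), ![a, b, c, d] (τ 1)] *
        σ ![![a, b, c, d] (τ 2), ![a, b, c, d] (τ 3)]) := by
    refine Eq.trans ?_ ((factorial_mul_aw_apply ω σ ![a, b, c, d]).trans ?_)
    · norm_num [Nat.factorial]
    · refine Finset.sum_congr rfl fun τ _ => ?_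
      rw [alt_two_eq ω, alt_two_eq σ]
      rfl
  simp [sum_perm_fin_succ, Fin.sum_univ_succ, Equiv.swap_apply_def,
    Equiv.Perm.decomposeFin.symm_sign, decomposeFin_symm_apply_two,
    decomposeFin_symm_apply_three, -Equiv.Perm.decomposeFin_symm_of_one] at h
  rw [alt_two_swap ω a b, alt_two_swap ω a c, alt_two_swap ω a d, alt_two_swap ω b c,
    alt_two_swap ω b d, alt_two_swap ω c d, alt_two_swap σ a b, alt_two_swap σ a c,
    alt_two_swap σ a d, alt_two_swap σ b c, alt_two_swap σ b d, alt_two_swap σ c d] at h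
  linear_combination h / 4

theorem wedgeCov_one_apply {V : Type*} [AddCommGroup V] [Module ℝ V]
    (α : Module.Dual ℝ V) (f : Fin 1 → V) : wedgeCov ![α] f = α (f 0) :=
  Matrix.det_unique (fun i j => ![α] j (f i))

theorem wedgeCov_three_apply {V : Type*} [AddCommGroup V] [Module ℝ V]
    (α β γ : Module.Dual ℝ V) (x y z : V) :
    wedgeCov ![α, β, γ] ![x, y, z] =
      α x * (β y * γ z - γ y * β z) - β x * (α y * γ z - γ y * α z)
        + γ x * (α y * β z - β y * α z) := by
  have : wedgeCov ![α, β, γ] ![x, y, z] =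
      Matrix.det !![α x, β x, γ x; α y, β y, γ y; α z, β z, γ z] := by
    change Matrix.det (fun i j => ![α, β, γ] j (![x, y, z] i)) = _
    congr 1
    ext i j
    fin_cases i <;> fin_cases j <;> rfl
  rw [this, Matrix.det_fin_three]
  simp only [Matrix.of_apply, Matrix.cons_val]
  ring

theorem aw_one_two_apply {V : Type*} [AddCommGroup V] [Module ℝ V]
    (α : Module.Dual ℝ V) (ω : V [⋀^Fin 2]→ₗ[ℝ] ℝ) (x y z : V) :
    (aw (wedgeCov ![α]) ω : V [⋀^Fin 3]→ₗ[ℝ] ℝ) ![x, y, z] =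
      α x * ω ![y, z] - α y * ω ![x, z] + α z * ω ![x, y] := by
  have h : (2 : ℝ) * (aw (wedgeCov ![α]) ω : V [⋀^Fin 3]→ₗ[ℝ] ℝ) ![x, y, z] =
      ∑ τ : Equiv.Perm (Fin 3), ((Equiv.Perm.sign τ : ℤ) : ℝ) * (α (![x, y, z] (τ 0)) *
        ω ![![x, y, z] (τ 1), ![x, y, z] (τ 2)]) := by
    refine Eq.trans ?_ ((factorial_mul_aw_apply (wedgeCov ![α]) ω ![x, y, z]).trans ?_)
    · norm_num [Nat.factorial]
    · refine Finset.sum_congr rfl fun τ _ => ?_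
      rw [alt_two_eq ω, wedgeCov_one_apply]
      rfl
  simp [sum_perm_fin_succ, Fin.sum_univ_succ, Equiv.swap_apply_def,
    Equiv.Perm.decomposeFin.symm_sign, decomposeFin_symm_apply_two,
    -Equiv.Perm.decomposeFin_symm_of_one] at h
  rw [alt_two_swap ω x y, alt_two_swap ω x z, alt_two_swap ω y z] at h
  linear_combination h / 2

theorem pi_surjective_of_linearIndependent {V : Type*} [AddCommGroup V] [Module ℝ V] {n : ℕ}
    (φ : Fin n → Module.Dual ℝ V) (hφ : LinearIndependent ℝ φ) :
    Function.Surjective (LinearMap.pi φ) := by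
  rw [← LinearMap.dualMap_injective_iff, injective_iff_map_eq_zero]
  intro ψ hψ
  have h0 := Fintype.linearIndependent_iff.mp hφ (fun i => ψ (Pi.single i 1)) (by
    ext w
    have := LinearMap.congr_fun hψ w
    have hs : LinearMap.pi φ w = ∑ i, φ i w • Pi.single i (1 : ℝ) := by
      ext j
      simp [Finset.sum_apply, Pi.single_apply]
    rw [LinearMap.dualMap_apply, hs, map_sum] at this
    simpa [mul_comm] using this)
  ext i
  simpa using h0 i

/-- An alternating two-form, viewed as a bilinear map. -/
noncomputable def altBilin {V : Type*} [AddCommGroup V] [Module ℝ V] (ω : V [⋀^Fin 2]→ₗ[ℝ] ℝ) :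
    V →ₗ[ℝ] V →ₗ[ℝ] ℝ :=
  LinearMap.mk₂ ℝ (fun x y => ω ![x, y])
    (fun x x' y => ω.map_vecCons_add ![y] x x')
    (fun c x y => ω.map_vecCons_smul ![y] c x)
    (fun x y y' => by
      rw [alt_two_swap ω (y + y'), alt_two_swap ω y, alt_two_swap ω y',
        ← neg_add]
      exact congrArg Neg.neg (ω.map_vecCons_add ![x] y y'))
    (fun c x y => by
      rw [alt_two_swap ω (c • y), alt_two_swap ω y, smul_neg]
      exact congrArg Neg.neg (ω.map_vecCons_smul ![x] c y))

theorem altBilin_apply {V : Type*} [AddCommGroup V] [Module ℝ V] (ω : V [⋀^Fin 2]→ₗ[ℝ] ℝ)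
    (x y : V) : altBilin ω x y = ω ![x, y] := rfl

theorem altBilin_isAlt {V : Type*} [AddCommGroup V] [Module ℝ V] (ω : V [⋀^Fin 2]→ₗ[ℝ] ℝ) :
    (altBilin ω).IsAlt := fun x =>
  ω.map_eq_zero_of_eq ![x, x] (i := 0) (j := 1) rfl (by decide)

theorem ker_altBilin {V : Type*} [AddCommGroup V] [Module ℝ V] (ω : V [⋀^Fin 2]→ₗ[ℝ] ℝ) :
    LinearMap.ker (altBilin ω) = LinearMap.ker ω.curryLeft := by
  ext x
  simp only [LinearMap.mem_ker]
  constructor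
  · intro hx
    ext f
    rw [show f = ![f 0] by ext i; fin_cases i; rfl]
    exact LinearMap.congr_fun hx (f 0)
  · intro hx
    ext y
    exact congrArg (fun g => g ![y]) hx

/-- Half the value of `B ∧ B` on four vectors. -/
def pfaffian {V : Type*} [AddCommGroup V] [Module ℝ V] (B : V →ₗ[ℝ] V →ₗ[ℝ] ℝ) (a b c d : V) : ℝ :=
  B a b * B c d - B a c * B b d + B a d * B b c

/-- A pair of alternating bilinear maps `B₁`, `B₂` with `B₁ ∧ B₂ = 0` and
`B₁ ∧ B₁ = B₂ ∧ B₂ ≠ 0`. -/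
structure IsConformalPair {V : Type*} [AddCommGroup V] [Module ℝ V]
    (B₁ B₂ : V →ₗ[ℝ] V →ₗ[ℝ] ℝ) : Prop where
  isAlt₁ : B₁.IsAlt
  isAlt₂ : B₂.IsAlt
  ne_zero : ∃ a b c d, pfaffian B₁ a b c d ≠ 0
  square : ∀ a b c d, pfaffian B₂ a b c d = pfaffian B₁ a b c d
  cross : ∀ a b c d, B₁ a b * B₂ c d - B₁ a c * B₂ b d + B₁ a d * B₂ b c
    + B₁ b c * B₂ a d - B₁ b d * B₂ a c + B₁ c d * B₂ a b = 0

namespace IsConformalPair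

variable {V : Type*} [AddCommGroup V] [Module ℝ V] {B₁ B₂ : V →ₗ[ℝ] V →ₗ[ℝ] ℝ}

/-- Every nonzero member of the pencil has the same kernel as `B₁`. -/
theorem eq_zero_of_pencil (hB : IsConformalPair B₁ B₂) {s t : ℝ} (hst : s ≠ 0 ∨ t ≠ 0) {v : V}
    (hv : ∀ w, s * B₁ v w + t * B₂ v w = 0) (w : V) : B₁ v w = 0 := by
  have hpos : s ^ 2 + t ^ 2 ≠ 0 := by
    rcases hst with h | h <;> positivity
  have hpf : ∀ a b c, pfaffian B₁ v a b c = 0 := fun a b c => by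
    refine (mul_eq_zero.mp ?_).resolve_left hpos
    have h2 := hB.square v a b c
    have h12 := hB.cross v a b c
    simp only [pfaffian] at h2 ⊢
    linear_combination (s * B₁ b c + t * B₂ b c) * hv a - (s * B₁ a c + t * B₂ a c) * hv b
      + (s * B₁ a b + t * B₂ a b) * hv c - t ^ 2 * h2 - s * t * h12
  by_contra hw
  obtain ⟨a, b, c, d, hne⟩ := hB.ne_zero
  refine hne ((mul_eq_zero.mp ?_).resolve_left (pow_ne_zero 2 hw))
  have h := fun b c => hpf w b c
  simp only [pfaffian] at h ⊢
  have skew : ∀ x y, B₁ x y = -B₁ y x := fun x y => (hB.isAlt₁.neg y x).symm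
  have e : ∀ b c, B₁ v w * B₁ b c = B₁ v b * B₁ w c - B₁ v c * B₁ w b := fun b c => by
    linear_combination h b c
  calc B₁ v w ^ 2 * (B₁ a b * B₁ c d - B₁ a c * B₁ b d + B₁ a d * B₁ b c)
      = (B₁ v w * B₁ a b) * (B₁ v w * B₁ c d) - (B₁ v w * B₁ a c) * (B₁ v w * B₁ b d)
        + (B₁ v w * B₁ a d) * (B₁ v w * B₁ b c) := by ring
    _ = 0 := by
      simp only [e]
      ring

/-- Vectors on which the pair takes its normal form. -/
theorem exists_frame (hB : IsConformalPair B₁ B₂) : ∃ f : Fin 4 → V,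
    (B₁ (f 0) (f 1) = 1 ∧ B₁ (f 0) (f 2) = 0 ∧ B₁ (f 0) (f 3) = 0 ∧
      B₁ (f 1) (f 2) = 0 ∧ B₁ (f 1) (f 3) = 0 ∧ B₁ (f 2) (f 3) = 1) ∧
    (B₂ (f 0) (f 1) = 0 ∧ B₂ (f 0) (f 2) = 1 ∧ B₂ (f 0) (f 3) = 0 ∧
      B₂ (f 1) (f 2) = 0 ∧ B₂ (f 1) (f 3) = -1 ∧ B₂ (f 2) (f 3) = 0) := by
  obtain ⟨x, w, hxw⟩ : ∃ x w, B₁ x w ≠ 0 := by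
    by_contra! h0
    obtain ⟨a, b, c, d, hne⟩ := hB.ne_zero
    exact hne (by simp [pfaffian, h0])
  have hx : LinearIndependent ℝ ![B₁ x, B₂ x] := by
    rw [LinearIndependent.pair_iff]
    intro s t hst
    by_contra hne
    refine hxw (hB.eq_zero_of_pencil (s := s) (t := t) (by tauto) (fun w => ?_) w)
    simpa using LinearMap.congr_fun hst w
  obtain ⟨y, hy⟩ := pi_surjective_of_linearIndependent _ hx ![1, 0]
  have hy1 : B₁ x y = 1 := by simpa using congrFun hy 0
  have hy2 : B₂ x y = 0 := by simpa using congrFun hy 1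
  have hyx1 : B₁ y x = -1 := by rw [← hB.isAlt₁.neg, hy1]
  have hyx2 : B₂ y x = 0 := by rw [← hB.isAlt₂.neg, hy2, neg_zero]
  have hli : LinearIndependent ℝ ![B₁ x, B₁ y, B₂ x, B₂ y] := by
    rw [Fintype.linearIndependent_iff]
    intro g hg
    have hg' : ∀ w, g 0 * B₁ x w + g 1 * B₁ y w + g 2 * B₂ x w + g 3 * B₂ y w = 0 := fun w => by
      simpa [Fin.sum_univ_four] using LinearMap.congr_fun hg w
    have h0 : g 0 = 0 := by
      simpa [hy1, hy2, hB.isAlt₁.self_eq_zero, hB.isAlt₂.self_eq_zero] using hg' y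
    have h1 : g 1 = 0 := by
      simpa [hyx1, hyx2, hB.isAlt₁.self_eq_zero, hB.isAlt₂.self_eq_zero] using hg' x
    have hz : ∀ w, B₂ (g 2 • x + g 3 • y) w = 0 := fun w => by
      simpa [h0, h1] using hg' w
    have hz1 := hB.eq_zero_of_pencil (s := 0) (t := 1) (v := g 2 • x + g 3 • y) (by simp)
      (fun w => by simpa using hz w)
    have h2 : g 2 = 0 := by simpa [hy1, hB.isAlt₁.self_eq_zero] using hz1 y
    have h3 : g 3 = 0 := by simpa [hyx1, hB.isAlt₁.self_eq_zero] using hz1 x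
    intro i
    fin_cases i <;> assumption
  obtain ⟨z, hz⟩ := pi_surjective_of_linearIndependent _ hli ![0, 0, 1, 0]
  obtain ⟨t, ht⟩ := pi_surjective_of_linearIndependent _ hli ![0, 0, 0, -1]
  have z0 : B₁ x z = 0 := by simpa using congrFun hz 0
  have z1 : B₁ y z = 0 := by simpa using congrFun hz 1
  have z2 : B₂ x z = 1 := by simpa using congrFun hz 2
  have z3 : B₂ y z = 0 := by simpa using congrFun hz 3
  have t0 : B₁ x t = 0 := by simpa using congrFun ht 0
  have t1 : B₁ y t = 0 := by simpa using congrFun ht 1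
  have t2 : B₂ x t = 0 := by simpa using congrFun ht 2
  have t3 : B₂ y t = -1 := by simpa using congrFun ht 3
  have zt1 : B₁ z t = 1 := by
    have := hB.square x y z t
    simp only [pfaffian, hy1, hy2, z0, z1, z2, z3, t0, t1, t2, t3] at this
    linarith
  have zt2 : B₂ z t = 0 := by
    have := hB.cross x y z t
    simp only [hy1, hy2, z0, z1, z2, z3, t0, t1, t2, t3] at this
    linarith
  exact ⟨![x, y, z, t], ⟨hy1, z0, t0, z1, t1, zt1⟩, ⟨hy2, z2, t2, z3, t3, zt2⟩⟩

/-- The simultaneous normal form `B₁ = v¹² + v³⁴`, `B₂ = v¹³ - v²⁴`. -/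
theorem exists_coframe [Module.Finite ℝ V] (hB : IsConformalPair B₁ B₂)
    (hker : LinearMap.ker B₁ = LinearMap.ker B₂)
    (hrank : finrank ℝ (LinearMap.ker B₁) + 4 = finrank ℝ V) :
    ∃ v : Fin 4 → Dual ℝ V,
      (∀ x y, B₁ x y = v 0 x * v 1 y - v 1 x * v 0 y + (v 2 x * v 3 y - v 3 x * v 2 y)) ∧
      (∀ x y, B₂ x y = v 0 x * v 2 y - v 2 x * v 0 y - (v 1 x * v 3 y - v 3 x * v 1 y)) ∧
      ∀ x, (∀ i, v i x = 0) → x ∈ LinearMap.ker B₁ := by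
  obtain ⟨f, ⟨p01, p02, p03, p12, p13, p23⟩, q01, q02, q03, q12, q13, q23⟩ := hB.exists_frame
  have s1 : ∀ a b, B₁ a b = -B₁ b a := fun a b => (hB.isAlt₁.neg b a).symm
  have s2 : ∀ a b, B₂ a b = -B₂ b a := fun a b => (hB.isAlt₂.neg b a).symm
  let v : Fin 4 → Dual ℝ V := ![-B₁ (f 1), B₁ (f 0), -B₁ (f 3), B₁ (f 2)]
  have hvf : ∀ c : Fin 4 → ℝ, ∀ i, v i (∑ j, c j • f j) = c i := fun c i => by
    fin_cases i <;>
    simp [v, Fin.sum_univ_four, p01, p02, p03, p12, p13, p23, hB.isAlt₁.self_eq_zero,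
      s1 (f 1) (f 0), s1 (f 2) (f 0), s1 (f 3) (f 0), s1 (f 2) (f 1), s1 (f 3) (f 1),
      s1 (f 3) (f 2)]
  have hsurj : Function.Surjective (LinearMap.pi v) := fun c =>
    ⟨∑ j, c j • f j, funext fun i => hvf c i⟩
  have hle : LinearMap.ker B₁ ≤ LinearMap.ker (LinearMap.pi v) := fun x hx => by
    have hx' : ∀ w, B₁ w x = 0 := fun w => by
      rw [s1, LinearMap.mem_ker.mp hx]; simp
    rw [LinearMap.mem_ker]
    ext i
    fin_cases i <;> simp [v, hx']
  have heq : LinearMap.ker B₁ = LinearMap.ker (LinearMap.pi v) := by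
    refine Submodule.eq_of_le_of_finrank_eq hle ?_
    have := LinearMap.finrank_range_add_finrank_ker (LinearMap.pi v)
    rw [LinearMap.range_eq_top.mpr hsurj, finrank_top, finrank_fin_fun] at this
    omega
  have hmem : ∀ x, (∀ i, v i x = 0) → x ∈ LinearMap.ker B₁ := fun x hx => by
    rw [heq, LinearMap.mem_ker]
    exact funext hx
  have hres : ∀ x, x - ∑ j, v j x • f j ∈ LinearMap.ker B₁ := fun x =>
    hmem _ fun i => by rw [map_sub, hvf fun j => v j x, sub_self]
  have hred : ∀ B : V →ₗ[ℝ] V →ₗ[ℝ] ℝ, B.IsAlt → LinearMap.ker B₁ = LinearMap.ker B →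
      ∀ x y, B x y = B (∑ j, v j x • f j) (∑ j, v j y • f j) := fun B hA hk x y => by
    have h1 : ∀ x w, B x w = B (∑ j, v j x • f j) w := fun x w => by
      have := hk ▸ hres x
      rw [LinearMap.mem_ker, map_sub, sub_eq_zero] at this
      rw [← this]
    rw [h1, ← hA.neg, h1 y, hA.neg]
  refine ⟨v, fun x y => ?_, fun x y => ?_, hmem⟩
  · rw [hred B₁ hB.isAlt₁ rfl]
    simp only [Fin.sum_univ_four, map_add, map_smul, LinearMap.add_apply, LinearMap.smul_apply,
      smul_eq_mul, p01, p02, p03, p12, p13, p23, hB.isAlt₁.self_eq_zero,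
      s1 (f 1) (f 0), s1 (f 2) (f 0), s1 (f 3) (f 0), s1 (f 2) (f 1), s1 (f 3) (f 1),
      s1 (f 3) (f 2)]
    ring
  · rw [hred B₂ hB.isAlt₂ hker]
    simp only [Fin.sum_univ_four, map_add, map_smul, LinearMap.add_apply, LinearMap.smul_apply,
      smul_eq_mul, q01, q02, q03, q12, q13, q23, hB.isAlt₂.self_eq_zero,
      s2 (f 1) (f 0), s2 (f 2) (f 0), s2 (f 3) (f 0), s2 (f 2) (f 1), s2 (f 3) (f 1),
      s2 (f 3) (f 2)]
    ring

end IsConformalPair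

theorem isConformalPair_altBilin {V : Type*} [AddCommGroup V] [Module ℝ V]
    {ω₁ ω₂ : V [⋀^Fin 2]→ₗ[ℝ] ℝ} (h11 : aw ω₁ ω₁ ≠ 0) (h12 : aw ω₁ ω₂ = 0)
    (h22 : aw ω₂ ω₂ = aw ω₁ ω₁) : IsConformalPair (altBilin ω₁) (altBilin ω₂) where
  isAlt₁ := altBilin_isAlt ω₁
  isAlt₂ := altBilin_isAlt ω₂
  ne_zero := by
    by_contra! h0
    refine h11 (AlternatingMap.ext fun f => ?_)
    have hf : f = ![f 0, f 1, f 2, f 3] := by ext i; fin_cases i <;> rfl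
    have := h0 (f 0) (f 1) (f 2) (f 3)
    simp only [pfaffian, altBilin_apply] at this
    rw [hf]
    refine (aw_two_two_apply ω₁ ω₁ (f 0) (f 1) (f 2) (f 3)).trans ?_
    rw [AlternatingMap.zero_apply]
    linear_combination 2 * this
  square a b c d := by
    have := congrArg (fun g => g ![a, b, c, d]) h22
    have := (aw_two_two_apply ω₂ ω₂ a b c d).symm.trans
      (this.trans (aw_two_two_apply ω₁ ω₁ a b c d))
    simp only [pfaffian, altBilin_apply]
    linear_combination this / 2
  cross a b c d :=
    (aw_two_two_apply ω₁ ω₂ a b c d).symm.trans (congrArg (fun g => g ![a, b, c, d]) h12)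

/-!  STATEMENT 15.  Let `h` be a six-dimensional Lie algebra with linearly independent
one-forms `α₁, α₂`, a closed one-form `γ` vanishing on `ker(dα₁)`, and two-forms
`ω₁, ω₂` with `ω_i ∧ ω_j = δ_{ij}ω₁²`, `ω₁² ≠ 0`, `ker ω₁ = ker ω₂` two-dimensional and
complementary to `ker α₁ ∩ ker α₂`, such that `dα₁ = ω₁` and `dα₂ = ω₂ + γ ∧ α₁`.
Then `ρ := α₂ ∧ ω₁ − α₁ ∧ ω₂` is an exact `SL(3,ℂ)`-structure on `h`;
indeed `ρ = d(α₁ ∧ α₂)`. -/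
theorem exact_sl3c_from_two_forms
    (h : Type*) [LieRing h] [LieAlgebra ℝ h] [Module.Finite ℝ h]
    (hdim : Module.finrank ℝ h = 6)
    (α₁ α₂ γ : Module.Dual ℝ h)
    (hindep : LinearIndependent ℝ ![α₁, α₂])
    (ω₁ ω₂ : h [⋀^Fin 2]→ₗ[ℝ] ℝ)
    (hγclosed : ∀ x y : h, γ ⁅x, y⁆ = 0)
    (hγW : ∀ x : h, x ∈ LinearMap.ker ω₁.curryLeft → γ x = 0)
    (h11 : aw ω₁ ω₁ ≠ 0) (h12 : aw ω₁ ω₂ = 0) (h22 : aw ω₂ ω₂ = aw ω₁ ω₁)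
    (hkereq : LinearMap.ker ω₁.curryLeft = LinearMap.ker ω₂.curryLeft)
    (hkerdim : Module.finrank ℝ ↥(LinearMap.ker ω₁.curryLeft) = 2)
    (hcompl : IsCompl (LinearMap.ker ω₁.curryLeft)
      (LinearMap.ker α₁ ⊓ LinearMap.ker α₂))
    (hdα₁ : ∀ x y : h, -α₁ ⁅x, y⁆ = ω₁ ![x, y])
    (hdα₂ : ∀ x y : h, -α₂ ⁅x, y⁆ = ω₂ ![x, y] + (γ x * α₁ y - γ y * α₁ x)) :
    IsSL3 ((aw (wedgeCov ![α₂]) ω₁ - aw (wedgeCov ![α₁]) ω₂ :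
        h [⋀^Fin 3]→ₗ[ℝ] ℝ)) ∧
    (∀ x y z : h,
      (aw (wedgeCov ![α₂]) ω₁ - aw (wedgeCov ![α₁]) ω₂ : h [⋀^Fin 3]→ₗ[ℝ] ℝ) ![x, y, z] =
        -(α₁ ⁅x, y⁆ * α₂ z - α₁ z * α₂ ⁅x, y⁆) + (α₁ ⁅x, z⁆ * α₂ y - α₁ y * α₂ ⁅x, z⁆) -
          (α₁ ⁅y, z⁆ * α₂ x - α₁ x * α₂ ⁅y, z⁆)) := by
  refine ⟨?_, fun x y z => ?_⟩
  · obtain ⟨v, hv1, hv2, hker⟩ := (isConformalPair_altBilin h11 h12 h22).exists_coframe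
      (by rw [ker_altBilin, ker_altBilin, hkereq]) (by rw [ker_altBilin, hkerdim, hdim])
    simp only [altBilin_apply] at hv1 hv2
    rw [ker_altBilin] at hker
    let u : h →ₗ[ℝ] (Fin 6 → ℝ) := LinearMap.pi ![α₁, α₂, v 2, v 1, v 0, -v 3]
    have hu : Function.Injective u := by
      rw [injective_iff_map_eq_zero]
      intro x hx
      have hα : x ∈ LinearMap.ker α₁ ⊓ LinearMap.ker α₂ := ⟨congrFun hx 0, congrFun hx 1⟩
      refine Submodule.disjoint_def.mp hcompl.disjoint x (hker x fun i => ?_) hα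
      fin_cases i
      · exact congrFun hx 4
      · exact congrFun hx 3
      · exact congrFun hx 2
      · exact neg_eq_zero.mp (congrFun hx 5)
    refine ⟨LinearEquiv.ofInjectiveOfFinrankEq u hu (by rw [hdim, finrank_fin_fun]), ?_⟩
    ext f
    rw [show f = ![f 0, f 1, f 2] by ext i; fin_cases i <;> rfl]
    generalize f 0 = x, f 1 = y, f 2 = z
    rw [AlternatingMap.sub_apply, aw_one_two_apply, aw_one_two_apply]
    simp only [hv1, hv2]
    have hcomp : rho0.compLinearMap u ![x, y, z] = rho0 ![u x, u y, u z] := by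
      rw [AlternatingMap.compLinearMap_apply]
      congr 1
      ext i; fin_cases i <;> rfl
    refine Eq.trans ?_ hcomp.symm
    have e : ∀ w i, pr i (u w) = ![α₁ w, α₂ w, v 2 w, v 1 w, v 0 w, -v 3 w] i := fun w i => by
      fin_cases i <;> rfl
    simp only [rho0, AlternatingMap.sub_apply, wedgeCov_three_apply, e, Matrix.cons_val]
    ring
  · rw [AlternatingMap.sub_apply, aw_one_two_apply, aw_one_two_apply]
    simp only [← hdα₁, show ∀ x y, ω₂ ![x, y] = -α₂ ⁅x, y⁆ - (γ x * α₁ y - γ y * α₁ x) from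
      fun x y => by rw [hdα₂]; ring]
    ring
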